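/- Let (λ_n) be a sequence of positive reals tending to infinity and set q_n = exp(-π/λ_n). Then there exist C > 0 and N such that for all n ≥ N, |1/(q_n; q_n)_∞ - exp(π λ_n/6 - π/(24 λ_n))/√(2 λ_n) · 1| ≤ exp(π λ_n/6 - π/(24 λ_n))/√(2 λ_n) · C exp(-4 π λ_n). -/

import Mathlib

open Real Filter

/-- The Euler product `∏ (1 - x ^ (k + 1))` commutes with the coercion from `ℝ` to `ℂ`. -/
lemma ofReal_tprod_one_sub_pow {x : ℝ} (hx : ‖x‖ < 1) :
    ((∏' k : ℕ, (1 - x ^ (k + 1)) : ℝ) : ℂ) = ∏' k : ℕ, (1 - (x : ℂ) ^ (k + 1)) := by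
  have hm : Multipliable fun k : ℕ ↦ 1 - x ^ (k + 1) := by
    simp_rw [sub_eq_add_neg]
    apply multipliable_one_add_of_summable
    simpa using (summable_nat_add_iff 1).mpr (summable_geometric_of_lt_one (norm_nonneg _) hx)
  simpa using hm.map_tprod Complex.ofRealHom Complex.continuous_ofReal

lemma csqrt_ofReal_mul_I {r : ℝ} (hr : 0 < r) :
    Complex.sqrt (r * Complex.I) = (√r : ℝ) * Complex.sqrt Complex.I := by
  rw [_root_.sqrt_eq_exp (by simp [hr.ne']), _root_.sqrt_eq_exp Complex.I_ne_zero,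
    Complex.log_ofReal_mul hr Complex.I_ne_zero, add_div, Complex.exp_add,
    Real.sqrt_eq_rpow, Real.rpow_def_of_pos hr]
  push_cast
  ring_nf

/-- The value of the Dedekind eta function on the imaginary axis, as a real product. -/
lemma eta_ofReal_mul_I {y : ℝ} (hy : 0 < y) :
    ModularForm.eta (y * Complex.I) =
      ((rexp (-π * y / 12) * ∏' k : ℕ, (1 - rexp (-2 * π * y) ^ (k + 1)) : ℝ) : ℂ) := by
  have hlt : ‖rexp (-2 * π * y)‖ < 1 := by
    rw [Real.norm_of_nonneg (exp_pos _).le, exp_lt_one_iff]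
    nlinarith [mul_pos pi_pos hy]
  have hq (h : ℝ) : Function.Periodic.qParam h (y * Complex.I) = rexp (-2 * π * y / h) := by
    rw [Function.Periodic.qParam, Complex.ofReal_exp]
    congr 1
    push_cast
    linear_combination (2 * π * y / h : ℂ) * Complex.I_sq
  rw [Complex.ofReal_mul, ofReal_tprod_one_sub_pow hlt, ModularForm.eta, hq 24]
  simp only [ModularForm.eta_q, hq 1, div_one]
  ring_nf

/-- The modular transformation of the Euler product. -/
lemma tprod_one_sub_exp_pow_eq {t : ℝ} (ht : 0 < t) :
    ∏' k : ℕ, (1 - rexp (-π / t) ^ (k + 1)) =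
      √(2 * t) * rexp (π / (24 * t) - π * t / 6) *
        ∏' k : ℕ, (1 - rexp (-4 * π * t) ^ (k + 1)) := by
  have h2t : 0 < 2 * t := by positivity
  have hS := ModularForm.eta_comp_eq_csqrt_I_inv
    (show ((2 * t : ℝ) * Complex.I : ℂ) ∈ UpperHalfPlane.upperHalfPlaneSet by
      simpa [UpperHalfPlane.upperHalfPlaneSet] using ht)
  have hinv : -1 / (((2 * t : ℝ) : ℂ) * Complex.I) = (((2 * t)⁻¹ : ℝ) : ℂ) * Complex.I := by
    have : (t : ℂ) ≠ 0 := by exact_mod_cast ht.ne'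
    push_cast
    field_simp
    simp
  have hI : Complex.sqrt Complex.I ≠ 0 := by
    rw [_root_.sqrt_eq_exp Complex.I_ne_zero]
    exact Complex.exp_ne_zero _
  simp only [Function.comp_apply, Pi.smul_apply, Pi.mul_apply, smul_eq_mul] at hS
  rw [hinv, csqrt_ofReal_mul_I h2t, mul_comm _ (Complex.sqrt Complex.I), mul_assoc,
    inv_mul_cancel_left₀ hI, eta_ofReal_mul_I h2t,
    eta_ofReal_mul_I (inv_pos.mpr h2t)] at hS
  have hR := Complex.ofReal_injective (hS.trans (Complex.ofReal_mul _ _).symm)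
  rw [show -2 * π * (2 * t)⁻¹ = -π / t by field_simp,
    show -2 * π * (2 * t) = -4 * π * t by ring,
    show -π * (2 * t)⁻¹ / 12 = -(π / (24 * t)) by field_simp; norm_num,
    show -π * (2 * t) / 12 = -(π * t / 6) by ring, Real.exp_neg,
    inv_mul_eq_iff_eq_mul₀ (exp_pos _).ne'] at hR
  rw [hR, sub_eq_add_neg, Real.exp_add]
  ring

/-- The reciprocal Euler product is `1 + O(x)` at the origin. -/
lemma one_div_tprod_one_sub_pow_sub_one_isBigO :
    (fun x : ℝ ↦ 1 / ∏' k : ℕ, (1 - x ^ (k + 1)) - 1) =O[nhds 0] fun x ↦ x := by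
  have h0 : ∏' k : ℕ, (1 - (0 : ℂ) ^ (k + 1)) = 1 := by simp
  have hd : DifferentiableAt ℂ (fun z : ℂ ↦ 1 / ∏' k : ℕ, (1 - z ^ (k + 1))) 0 :=
    .div (by fun_prop) (ModularForm.differentiableOn_tprod_one_sub_pow.differentiableAt
      (Metric.ball_mem_nhds 0 one_pos)) (by simp)
  have hO := hd.isBigO_sub.comp_tendsto
    (show Tendsto (fun x : ℝ ↦ (x : ℂ)) (nhds 0) (nhds 0) from
      Complex.continuous_ofReal.tendsto' 0 0 (by simp))
  refine Asymptotics.IsBigO.of_norm_norm (hO.norm_norm.congr' ?_ ?_)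
  · filter_upwards [Metric.ball_mem_nhds (0 : ℝ) one_pos] with x hx
    rw [Function.comp_apply, h0, ← ofReal_tprod_one_sub_pow (by simpa using hx)]
    rw [← Complex.norm_real]
    simp
  · filter_upwards with x
    simp

theorem euler_product_reciprocal_asymptotics (lam : ℕ → ℝ) (hpos : ∀ n, 0 < lam n)
    (hlim : Tendsto lam atTop atTop) (q : ℕ → ℝ) (hq : ∀ n, q n = Real.exp (-π / lam n)) :
    ∃ C > 0, ∃ N : ℕ, ∀ n ≥ N,
      |1 / (∏' k : ℕ, (1 - (q n) ^ (k + 1))) -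
          Real.exp (π * lam n / 6 - π / (24 * lam n)) / Real.sqrt (2 * lam n)| ≤
        Real.exp (π * lam n / 6 - π / (24 * lam n)) / Real.sqrt (2 * lam n) *
          (C * Real.exp (-4 * π * lam n)) := by
  have hexp : Tendsto (fun n ↦ rexp (-4 * π * lam n)) atTop (nhds 0) :=
    tendsto_exp_atBot.comp
      (hlim.const_mul_atTop_of_neg (by linarith [pi_pos] : -4 * π < 0))
  obtain ⟨C, hC, hbound⟩ :=
    (one_div_tprod_one_sub_pow_sub_one_isBigO.comp_tendsto hexp).exists_pos
  obtain ⟨N, hN⟩ := eventually_atTop.mp hbound.bound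
  refine ⟨C, hC, N, fun n hn ↦ ?_⟩
  have hB := hN n hn
  simp only [Function.comp_apply, Real.norm_eq_abs, abs_exp] at hB
  set A := rexp (π * lam n / 6 - π / (24 * lam n)) / √(2 * lam n) with hA
  have hA0 : 0 ≤ A := by positivity
  have hfac : 1 / ∏' k : ℕ, (1 - q n ^ (k + 1)) =
      A * (1 / ∏' k : ℕ, (1 - rexp (-4 * π * lam n) ^ (k + 1))) := by
    rw [hq n, tprod_one_sub_exp_pow_eq (hpos n), hA,
      ← neg_sub (π * lam n / 6) (π / (24 * lam n)), Real.exp_neg]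
    simp only [one_div, mul_inv, inv_inv]
    ring
  rw [hfac, ← mul_sub_one, abs_mul, abs_of_nonneg hA0]
  gcongr
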